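/- For all binary trees t1 and t2 (possibly empty), c_{t1} ▷ c_{t2} = ĉ(w(t1,t2)), where ĉ is the linear map sending a binary tree t to c_t, and w(t1,t2) is the integer linear combination of binary trees defined recursively by w(t1,∅) = t1∧∅ and w(t1, t2∧t3) = t1∧(t2∧t3) + w(t1,t2)∧t3 + t2∧w(t1,t3) − (t1∧t2)∧t3 − (t2∧t1)∧t3, with ∧ extended bilinearly. In particular, the linear span of { c_t } is closed under the preLie product ▷. -/

import Mathlib

/-- The free module on words of positive integers, with coefficients in `R`.
`ℚ[S_n]` is identified with the span of the permutation words of {1,…,n}. -/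
abbrev FW (R : Type) [CommRing R] := (List ℕ) →₀ R

variable {R : Type} [CommRing R]

/-- Concatenation product, extended bilinearly. -/
noncomputable def catW (x y : FW R) : FW R :=
  x.sum fun u a => y.sum fun v b => Finsupp.single (u ++ v) (a * b)

/-- The bracket [x,y] = x·y − y·x of the concatenation product. -/
noncomputable def brakW (x y : FW R) : FW R := catW x y - catW y x

/-- (Incomplete) binary trees; `nil` is the empty tree. The complete binary tree with
`t.nodes + 1` leaves whose internal nodes form `t` is implicit in the definitions below. -/
inductive BT
  | nil : BT
  | nd : BT → BT → BT
deriving DecidableEq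

/-- Number of nodes of a binary tree. -/
def BT.nodes : BT → ℕ
  | .nil => 0
  | .nd l r => l.nodes + r.nodes + 1

/-- The evaluation T(σ) of the complete binary tree `T` whose internal nodes form `t`, with
leaves labelled left to right by the word `w`: each leaf gets the one-letter word of its label
and each internal node the bracket of concatenation. -/
noncomputable def evalBT : BT → List ℕ → FW R
  | .nil, w => Finsupp.single w 1
  | .nd l r, w => brakW (evalBT l (w.take (l.nodes + 1))) (evalBT r (w.drop (l.nodes + 1)))

/-- The standardization of a word with distinct letters: each letter is replaced by its rank. -/
def stdW (w : List ℕ) : List ℕ := w.map fun x => (w.filter (· ≤ x)).length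

/-- The set of permutation words of {1, …, n}. -/
def permWords (n : ℕ) : Finset (List ℕ) := (List.range' 1 n).permutations.toFinset

/-- Convolution α⋆β of two permutation words: the sum of all permutation words γ of size
|α|+|β| with std(γ(1)⋯γ(m)) = α and std(γ(m+1)⋯γ(m+n)) = β. -/
noncomputable def convW (u v : List ℕ) : FW R :=
  ∑ γ ∈ (permWords (u.length + v.length)).filter
      (fun γ => stdW (γ.take u.length) = u ∧ stdW (γ.drop u.length) = v),
    Finsupp.single γ 1

/-- The convolution product, extended bilinearly. -/
noncomputable def starW (x y : FW R) : FW R :=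
  x.sum fun u a => y.sum fun v b => (a * b) • convW u v

/-- Whether the word `w` is an admissible labelling of (the completion of) `t`: at each internal
node, the smallest label lies in the left subtree and the largest in the right subtree. -/
def admB : BT → List ℕ → Bool
  | .nil, _ => true
  | .nd l r, w =>
    admB l (w.take (l.nodes + 1)) && admB r (w.drop (l.nodes + 1))
      && decide ((w.take (l.nodes + 1)).minimum = w.minimum)
      && decide ((w.drop (l.nodes + 1)).maximum = w.maximum)

/-- c_t: the sum of the evaluations T(σ) over all admissible labellings σ of the complete
binary tree whose internal nodes form `t`. -/
noncomputable def cElt (t : BT) : FW R :=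
  ∑ w ∈ (permWords (t.nodes + 1)).filter (fun w => admB t w = true), evalBT t w


/-- Word-level half product α≻β: the sum of all permutation words γ of size m+n = |α|+|β| with
std(γ(1)⋯γ(m)) = α, std(γ(m+1)⋯γ(m+n)) = β and the letter m+n among the last n letters. -/
noncomputable def succW (u v : List ℕ) : FW R :=
  ∑ γ ∈ (permWords (u.length + v.length)).filter
      (fun γ => stdW (γ.take u.length) = u ∧ stdW (γ.drop u.length) = v
        ∧ (u.length + v.length) ∈ γ.drop u.length),
    Finsupp.single γ 1

/-- Word-level half product α≺β: the sum of all permutation words γ of size m+n = |α|+|β| with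
std(γ(1)⋯γ(m)) = α, std(γ(m+1)⋯γ(m+n)) = β and the letter m+n among the first m letters. -/
noncomputable def precW (u v : List ℕ) : FW R :=
  ∑ γ ∈ (permWords (u.length + v.length)).filter
      (fun γ => stdW (γ.take u.length) = u ∧ stdW (γ.drop u.length) = v
        ∧ (u.length + v.length) ∈ γ.take u.length),
    Finsupp.single γ 1

/-- α≻β extended bilinearly. -/
noncomputable def succExt (x y : FW R) : FW R :=
  x.sum fun u a => y.sum fun v b => (a * b) • succW u v

/-- α≺β extended bilinearly. -/
noncomputable def precExt (x y : FW R) : FW R :=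
  x.sum fun u a => y.sum fun v b => (a * b) • precW u v

/-- The preLie product x▷y = x≻y − y≺x. -/
noncomputable def preLieW (x y : FW R) : FW R := succExt x y - precExt y x

/-- The grafting ∧ extended bilinearly to the free ℤ-module on binary trees. -/
noncomputable def wedge2 (x y : BT →₀ ℤ) : BT →₀ ℤ :=
  x.sum fun s a => y.sum fun t b => Finsupp.single (BT.nd s t) (a * b)

/-- The combination w(t1,t2) of binary trees, defined recursively by w(t1,∅) = t1∧∅ and
w(t1, t2∧t3) = t1∧(t2∧t3) + w(t1,t2)∧t3 + t2∧w(t1,t3) − (t1∧t2)∧t3 − (t2∧t1)∧t3. -/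
noncomputable def wcomb : BT → BT → (BT →₀ ℤ)
  | t1, .nil => Finsupp.single (BT.nd t1 .nil) 1
  | t1, .nd t2 t3 =>
    Finsupp.single (BT.nd t1 (BT.nd t2 t3)) 1
      + wedge2 (wcomb t1 t2) (Finsupp.single t3 1)
      + wedge2 (Finsupp.single t2 1) (wcomb t1 t3)
      - Finsupp.single (BT.nd (BT.nd t1 t2) t3) 1
      - Finsupp.single (BT.nd (BT.nd t2 t1) t3) 1

/-- ĉ: the linear map sending a binary tree t to c_t. -/
noncomputable def chat (x : BT →₀ ℤ) : FW ℚ := x.sum fun t a => (a : ℚ) • cElt t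

/-! ### Bilinearity of concatenation and bracket -/

theorem catW_single (u v : List ℕ) (a b : ℚ) :
    catW (Finsupp.single u a) (Finsupp.single v b) = Finsupp.single (u ++ v) (a * b) := by
  simp [catW]

theorem catW_add_left (x y z : FW ℚ) : catW (x + y) z = catW x z + catW y z := by
  unfold catW
  rw [Finsupp.sum_add_index']
  · simp
  · intro u a b
    rw [← Finsupp.sum_add]
    simp [add_mul]

theorem catW_add_right (x y z : FW ℚ) : catW x (y + z) = catW x y + catW x z := by
  unfold catW
  rw [← Finsupp.sum_add]
  congr 1
  funext u a
  rw [Finsupp.sum_add_index']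
  · simp
  · simp [mul_add]

theorem catW_smul_left (c : ℚ) (x y : FW ℚ) : catW (c • x) y = c • catW x y := by
  unfold catW
  rw [Finsupp.sum_smul_index (by simp), Finsupp.smul_sum]
  congr 1
  funext u a
  simp only [Finsupp.smul_sum, Finsupp.smul_single, smul_eq_mul, mul_assoc]

theorem catW_smul_right (c : ℚ) (x y : FW ℚ) : catW x (c • y) = c • catW x y := by
  unfold catW
  rw [Finsupp.smul_sum]
  congr 1
  funext u a
  rw [Finsupp.sum_smul_index (by simp), Finsupp.smul_sum]
  simp only [Finsupp.smul_single, smul_eq_mul, mul_left_comm]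

/-- Concatenation as a bilinear map. -/
noncomputable def catHom : FW ℚ →ₗ[ℚ] FW ℚ →ₗ[ℚ] FW ℚ :=
  LinearMap.mk₂ ℚ catW catW_add_left catW_smul_left catW_add_right catW_smul_right

theorem catHom_apply (x y : FW ℚ) : catHom x y = catW x y := rfl

/-- The commutator bracket as a bilinear map. -/
noncomputable def brakHom : FW ℚ →ₗ[ℚ] FW ℚ →ₗ[ℚ] FW ℚ := catHom - catHom.flip

theorem brakHom_apply (x y : FW ℚ) : brakHom x y = brakW x y := rfl

theorem catW_assoc (x y z : FW ℚ) : catW (catW x y) z = catW x (catW y z) := by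
  simp only [← catHom_apply]
  induction x using Finsupp.induction_linear with
  | zero => simp
  | add a b ha hb => simp [ha, hb]
  | single u a =>
    induction y using Finsupp.induction_linear with
    | zero => simp
    | add a b ha hb => simp [ha, hb]
    | single v b =>
      induction z using Finsupp.induction_linear with
      | zero => simp
      | add a b ha hb => simp [ha, hb]
      | single w c => simp only [catHom_apply, catW_single, mul_assoc, List.append_assoc]

theorem brakHom_jacobi (x y z : FW ℚ) :
    brakHom x (brakHom y z) = brakHom (brakHom x y) z + brakHom y (brakHom x z) := by
  simp only [brakHom, LinearMap.sub_apply, LinearMap.flip_apply, map_sub]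
  simp only [catHom_apply, catW_assoc]
  abel

theorem brakHom_skew (x y : FW ℚ) : brakHom x y = -brakHom y x := by
  simp only [brakHom, LinearMap.sub_apply, LinearMap.flip_apply]
  abel

/-! ### Products of set-indexed families -/

open Finset

/-- The sum of the brackets of `f B` and `g C` over all decompositions `A = B ⊔ C` such that
`p B C` holds. -/
noncomputable def splitBrak (p : Finset ℕ → Finset ℕ → Prop) [∀ B C, Decidable (p B C)]
    (f g : Finset ℕ → FW ℚ) (A : Finset ℕ) : FW ℚ :=
  ∑ B ∈ A.powerset, if p B (A \ B) then brakHom (f B) (g (A \ B)) else 0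

/-- The set-indexed version of the preLie product. -/
noncomputable abbrev preS (f g : Finset ℕ → FW ℚ) : Finset ℕ → FW ℚ :=
  splitBrak (fun B C => B.max < C.max) f g

/-- The set-indexed version of grafting. -/
noncomputable abbrev wedgeS (f g : Finset ℕ → FW ℚ) : Finset ℕ → FW ℚ :=
  splitBrak (fun B C => B.max < C.max ∧ B.min < C.min) f g

section splitBrak

variable (p q : Finset ℕ → Finset ℕ → Prop) [∀ B C, Decidable (p B C)] [∀ B C, Decidable (q B C)]

theorem splitBrak_add_left (f f' g : Finset ℕ → FW ℚ) :
    splitBrak p (f + f') g = splitBrak p f g + splitBrak p f' g := by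
  funext A
  simp only [splitBrak, Pi.add_apply, ← sum_add_distrib]
  refine sum_congr rfl fun B _ => ?_
  split_ifs <;> simp

theorem splitBrak_add_right (f g g' : Finset ℕ → FW ℚ) :
    splitBrak p f (g + g') = splitBrak p f g + splitBrak p f g' := by
  funext A
  simp only [splitBrak, Pi.add_apply, ← sum_add_distrib]
  refine sum_congr rfl fun B _ => ?_
  split_ifs <;> simp

theorem splitBrak_smul_left (c : ℚ) (f g : Finset ℕ → FW ℚ) :
    splitBrak p (c • f) g = c • splitBrak p f g := by
  funext A
  simp only [splitBrak, Pi.smul_apply, smul_sum]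
  refine sum_congr rfl fun B _ => ?_
  split_ifs <;> simp

theorem splitBrak_smul_right (c : ℚ) (f g : Finset ℕ → FW ℚ) :
    splitBrak p f (c • g) = c • splitBrak p f g := by
  funext A
  simp only [splitBrak, Pi.smul_apply, smul_sum]
  refine sum_congr rfl fun B _ => ?_
  split_ifs <;> simp

theorem sum_powerset_powerset_sdiff (A : Finset ℕ)
    (φ : Finset ℕ → Finset ℕ → Finset ℕ → FW ℚ) :
    ∑ E ∈ A.powerset, ∑ B ∈ E.powerset, φ B (E \ B) (A \ E)
      = ∑ B ∈ A.powerset, ∑ C ∈ (A \ B).powerset, φ B C ((A \ B) \ C) := by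
  rw [sum_sigma', sum_sigma']
  refine sum_bij' (fun x _ => ⟨x.2, x.1 \ x.2⟩) (fun y _ => ⟨y.1 ∪ y.2, y.1⟩) ?_ ?_ ?_ ?_ ?_
  · rintro ⟨E, B⟩ h
    simp only [mem_sigma, mem_powerset] at h ⊢
    grind
  · rintro ⟨B, C⟩ h
    simp only [mem_sigma, mem_powerset] at h ⊢
    grind
  · rintro ⟨E, B⟩ h
    simp only [mem_sigma, mem_powerset] at h
    simp [union_eq_right.2 h.2]
  · rintro ⟨B, C⟩ h
    simp only [mem_sigma, mem_powerset] at h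
    have : (B ∪ C) \ B = C := by grind
    simp [this]
  · rintro ⟨E, B⟩ h
    simp only [mem_sigma, mem_powerset] at h
    have : (A \ B) \ (E \ B) = A \ E := by grind
    simp [this]

theorem sum_powerset_sdiff_comm (A : Finset ℕ)
    (φ : Finset ℕ → Finset ℕ → Finset ℕ → FW ℚ) :
    ∑ C ∈ A.powerset, ∑ B ∈ (A \ C).powerset, φ B C ((A \ C) \ B)
      = ∑ B ∈ A.powerset, ∑ C ∈ (A \ B).powerset, φ B C ((A \ B) \ C) := by
  rw [sum_sigma', sum_sigma']
  refine sum_bij' (fun x _ => ⟨x.2, x.1⟩) (fun y _ => ⟨y.2, y.1⟩) ?_ ?_ (by simp) (by simp) ?_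
  · rintro ⟨E, B⟩ h
    simp only [mem_sigma, mem_powerset] at h ⊢
    grind
  · rintro ⟨E, B⟩ h
    simp only [mem_sigma, mem_powerset] at h ⊢
    grind
  · rintro ⟨E, B⟩ h
    simp only [sdiff_sdiff_comm]

theorem splitBrak_splitBrak_right (f g h : Finset ℕ → FW ℚ) (A : Finset ℕ) :
    splitBrak p f (splitBrak q g h) A
      = ∑ B ∈ A.powerset, ∑ C ∈ (A \ B).powerset,
          if p B (C ∪ (A \ B) \ C) ∧ q C ((A \ B) \ C)
            then brakHom (f B) (brakHom (g C) (h ((A \ B) \ C))) else 0 := by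
  refine sum_congr rfl fun B _ => ?_
  simp only [splitBrak, map_sum]
  split_ifs with hp
  · refine sum_congr rfl fun C hC => ?_
    rw [union_sdiff_of_subset (mem_powerset.1 hC)]
    simp only [hp, true_and]
    split_ifs <;> simp
  · refine (sum_eq_zero fun C hC => ?_).symm
    rw [union_sdiff_of_subset (mem_powerset.1 hC)]
    simp [hp]

theorem splitBrak_splitBrak_left (f g h : Finset ℕ → FW ℚ) (A : Finset ℕ) :
    splitBrak p (splitBrak q f g) h A
      = ∑ B ∈ A.powerset, ∑ C ∈ (A \ B).powerset,
          if p (B ∪ C) ((A \ B) \ C) ∧ q B C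
            then brakHom (brakHom (f B) (g C)) (h ((A \ B) \ C)) else 0 := by
  rw [← sum_powerset_powerset_sdiff A fun B C D =>
    if p (B ∪ C) D ∧ q B C then brakHom (brakHom (f B) (g C)) (h D) else 0]
  refine sum_congr rfl fun E _ => ?_
  simp only [splitBrak, map_sum, LinearMap.sum_apply]
  split_ifs with hp
  · refine sum_congr rfl fun C hC => ?_
    rw [union_sdiff_of_subset (mem_powerset.1 hC)]
    simp only [hp, true_and]
    split_ifs <;> simp
  · refine (sum_eq_zero fun C hC => ?_).symm
    rw [union_sdiff_of_subset (mem_powerset.1 hC)]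
    simp [hp]

theorem splitBrak_splitBrak_right' (f g h : Finset ℕ → FW ℚ) (A : Finset ℕ) :
    splitBrak p g (splitBrak q f h) A
      = ∑ B ∈ A.powerset, ∑ C ∈ (A \ B).powerset,
          if p C (B ∪ (A \ B) \ C) ∧ q B ((A \ B) \ C)
            then brakHom (g C) (brakHom (f B) (h ((A \ B) \ C))) else 0 := by
  rw [splitBrak_splitBrak_right]
  exact sum_powerset_sdiff_comm A fun B C D =>
    if p C (B ∪ D) ∧ q B D then brakHom (g C) (brakHom (f B) (h D)) else 0

theorem splitBrak_splitBrak_left' (f g h : Finset ℕ → FW ℚ) (A : Finset ℕ) :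
    splitBrak p (splitBrak q g f) h A
      = ∑ B ∈ A.powerset, ∑ C ∈ (A \ B).powerset,
          if p (C ∪ B) ((A \ B) \ C) ∧ q C B
            then brakHom (brakHom (g C) (f B)) (h ((A \ B) \ C)) else 0 := by
  rw [splitBrak_splitBrak_left]
  exact sum_powerset_sdiff_comm A fun B C D =>
    if p (C ∪ B) D ∧ q C B then brakHom (brakHom (g C) (f B)) (h D) else 0

end splitBrak

theorem max_ne_max_of_disjoint {B C : Finset ℕ} (h : Disjoint B C) (hB : B.Nonempty) :
    B.max ≠ C.max := by
  obtain ⟨b, hb⟩ := max_of_nonempty hB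
  intro e
  exact disjoint_left.1 h (mem_of_max hb) (mem_of_max (e ▸ hb))

theorem min_ne_min_of_disjoint {B C : Finset ℕ} (h : Disjoint B C) (hB : B.Nonempty) :
    B.min ≠ C.min := by
  obtain ⟨b, hb⟩ := min_of_nonempty hB
  intro e
  exact disjoint_left.1 h (mem_of_min hb) (mem_of_min (e ▸ hb))

theorem preS_wedgeS (f g h : Finset ℕ → FW ℚ) (hf : f ∅ = 0) :
    preS f (wedgeS g h) = wedgeS f (wedgeS g h) + wedgeS (preS f g) h + wedgeS g (preS f h)
      - wedgeS (wedgeS f g) h - wedgeS (wedgeS g f) h := by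
  funext A
  simp only [preS, wedgeS, Pi.add_apply, Pi.sub_apply]
  rw [splitBrak_splitBrak_right, splitBrak_splitBrak_right, splitBrak_splitBrak_left,
    splitBrak_splitBrak_right', splitBrak_splitBrak_left, splitBrak_splitBrak_left']
  simp only [← sum_add_distrib, ← sum_sub_distrib]
  refine sum_congr rfl fun B _ => sum_congr rfl fun C hC => ?_
  obtain rfl | hB := B.eq_empty_or_nonempty
  · simp [hf]
  have hBC : Disjoint B C := (disjoint_sdiff (s := B)).mono_right (mem_powerset.1 hC)
  have hBD : Disjoint B ((A \ B) \ C) := (disjoint_sdiff (s := B)).mono_right sdiff_subset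
  generalize (A \ B) \ C = D at *
  have e1 := max_ne_max_of_disjoint hBC hB
  have e2 := max_ne_max_of_disjoint hBD hB
  have e3 := min_ne_min_of_disjoint hBC hB
  have e4 := min_ne_min_of_disjoint hBD hB
  have hmax : ∀ X Y : Finset ℕ, (X ∪ Y).max = max X.max Y.max := fun X Y => by
    simp [max_eq_sup_withBot, sup_union]
  have hmin : ∀ X Y : Finset ℕ, (X ∪ Y).min = min X.min Y.min := fun X Y => by
    simp [min_eq_inf_withTop, inf_union]
  rw [brakHom_jacobi (f B), brakHom_skew (g C) (f B)]
  simp only [hmax, hmin, map_neg, LinearMap.neg_apply]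
  generalize brakHom (brakHom (f B) (g C)) (h D) = x
  generalize brakHom (g C) (brakHom (f B) (h D)) = y
  generalize B.max = bM at *
  generalize C.max = cM at *
  generalize D.max = dM at *
  generalize B.min = bm at *
  generalize C.min = cm at *
  generalize D.min = dm at *
  simp only [lt_max_iff, max_lt_iff, lt_min_iff, min_lt_iff]
  rcases lt_or_gt_of_ne e1 with h1 | h1 <;> rcases lt_or_gt_of_ne e2 with h2 | h2 <;>
  rcases lt_or_gt_of_ne e3 with h3 | h3 <;> rcases lt_or_gt_of_ne e4 with h4 | h4 <;>
  simp only [h1, h2, h3, h4, h1.not_gt, h2.not_gt, h3.not_gt, h4.not_gt, true_and, and_true,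
    true_or, or_true, false_and, and_false, false_or, or_false, if_false] <;>
  (try split_ifs) <;> grind

/-! ### Words with a prescribed set of letters -/

/-- The words without repetition whose set of letters is `A`. -/
noncomputable def wordsOf (A : Finset ℕ) : Finset (List ℕ) := A.toList.permutations.toFinset

theorem mem_wordsOf {A : Finset ℕ} {w : List ℕ} :
    w ∈ wordsOf A ↔ w.Nodup ∧ w.toFinset = A := by
  simp only [wordsOf, List.mem_toFinset, List.mem_permutations]
  constructor
  · intro h
    exact ⟨h.nodup_iff.2 A.nodup_toList, by rw [List.toFinset_eq_of_perm _ _ h, toList_toFinset]⟩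
  · rintro ⟨h, rfl⟩
    exact List.perm_of_nodup_nodup_toFinset_eq h (nodup_toList _) (toList_toFinset _).symm

theorem length_of_mem_wordsOf {A : Finset ℕ} {w : List ℕ} (h : w ∈ wordsOf A) :
    w.length = A.card := by
  obtain ⟨hn, rfl⟩ := mem_wordsOf.1 h
  exact (List.toFinset_card_of_nodup hn).symm

theorem mem_of_mem_wordsOf {A : Finset ℕ} {w : List ℕ} (h : w ∈ wordsOf A) {a : ℕ} :
    a ∈ w ↔ a ∈ A := by
  rw [← (mem_wordsOf.1 h).2, List.mem_toFinset]

theorem wordsOf_singleton (a : ℕ) : wordsOf {a} = {[a]} := by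
  ext w
  simp [wordsOf]

theorem permWords_eq_wordsOf (n : ℕ) : permWords n = wordsOf (Icc 1 n) := by
  have h : (List.range' 1 n).toFinset = Icc 1 n := by
    ext a
    simp only [List.mem_toFinset, List.mem_range'_1, mem_Icc]
    omega
  ext w
  rw [mem_wordsOf, ← h, permWords, List.mem_toFinset, List.mem_permutations]
  constructor
  · intro p
    exact ⟨p.nodup_iff.2 (List.nodup_range' ..), List.toFinset_eq_of_perm _ _ p⟩
  · rintro ⟨h1, h2⟩
    exact List.perm_of_nodup_nodup_toFinset_eq h1 (List.nodup_range' ..) h2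

theorem append_mem_wordsOf {A B : Finset ℕ} (hB : B ⊆ A) {u v : List ℕ} (hu : u ∈ wordsOf B)
    (hv : v ∈ wordsOf (A \ B)) : u ++ v ∈ wordsOf A := by
  have hd : ∀ a ∈ u, a ∉ v := fun a ha hv' => by
    rw [mem_of_mem_wordsOf hu] at ha
    rw [mem_of_mem_wordsOf hv] at hv'
    exact (mem_sdiff.1 hv').2 ha
  rw [mem_wordsOf] at hu hv ⊢
  refine ⟨List.nodup_append'.2 ⟨hu.1, hv.1, hd⟩, ?_⟩
  rw [List.toFinset_append, hu.2, hv.2, union_sdiff_of_subset hB]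

theorem sum_wordsOf_take_drop (A : Finset ℕ) {k : ℕ} (hk : k ≤ A.card)
    (K : List ℕ → List ℕ → FW ℚ) :
    ∑ w ∈ wordsOf A, K (w.take k) (w.drop k)
      = ∑ B ∈ A.powerset with B.card = k, ∑ u ∈ wordsOf B, ∑ v ∈ wordsOf (A \ B), K u v := by
  simp_rw [← sum_product']
  rw [sum_sigma']
  refine sum_bij' (fun w _ => ⟨(w.take k).toFinset, (w.take k, w.drop k)⟩)
    (fun x _ => x.2.1 ++ x.2.2) ?_ ?_ ?_ ?_ ?_
  · intro w hw
    have hl := length_of_mem_wordsOf hw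
    obtain ⟨hn, rfl⟩ := mem_wordsOf.1 hw
    have hn' := hn
    rw [← List.take_append_drop k w, List.nodup_append'] at hn'
    simp only [mem_sigma, mem_filter, mem_powerset, mem_product, mem_wordsOf, and_true]
    refine ⟨⟨?_, ?_⟩, hn'.1, hn'.2.1, ?_⟩
    · intro a ha
      exact List.mem_toFinset.2 (List.mem_of_mem_take (List.mem_toFinset.1 ha))
    · rw [List.toFinset_card_of_nodup hn'.1, List.length_take]
      omega
    · have hw : w.toFinset = (w.take k).toFinset ∪ (w.drop k).toFinset := by
        rw [← List.toFinset_append, List.take_append_drop]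
      have hd : Disjoint (w.drop k).toFinset (w.take k).toFinset := by
        rw [disjoint_left]
        intro a ha hb
        exact hn'.2.2 (List.mem_toFinset.1 hb) (List.mem_toFinset.1 ha)
      rw [hw, union_sdiff_left, sdiff_eq_self_of_disjoint hd]
  · rintro ⟨B, u, v⟩ h
    simp only [mem_sigma, mem_filter, mem_powerset, mem_product] at h
    exact append_mem_wordsOf h.1.1 h.2.1 h.2.2
  · intro w _
    exact List.take_append_drop k w
  · rintro ⟨B, u, v⟩ h
    simp only [mem_sigma, mem_filter, mem_powerset, mem_product] at h
    have hu : u.length = k := (length_of_mem_wordsOf h.2.1).trans h.1.2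
    have hB : u.toFinset = B := (mem_wordsOf.1 h.2.1).2
    simp [← hu, hB]
  · intro w _
    rfl

theorem toFinset_max_eq_maximum (w : List ℕ) : w.toFinset.max = w.maximum := by
  induction w with
  | nil => simp
  | cons a w ih => rw [List.toFinset_cons, max_insert, ih, List.maximum_cons]

theorem toFinset_min_eq_minimum (w : List ℕ) : w.toFinset.min = w.minimum := by
  induction w with
  | nil => simp
  | cons a w ih => rw [List.toFinset_cons, min_insert, ih, List.minimum_cons]

/-! ### Set-indexed version of `cElt` -/

/-- The sum of the evaluations of all admissible labellings of `t` with set of labels `A`. -/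
noncomputable def cS : BT → Finset ℕ → FW ℚ
  | .nil, A => if A.card = 1 then ∑ w ∈ wordsOf A, Finsupp.single w 1 else 0
  | .nd l r, A => wedgeS (cS l) (cS r) A

theorem cS_nd (l r : BT) : cS (.nd l r) = wedgeS (cS l) (cS r) := by
  funext A
  rw [cS]

theorem cS_eq_zero (t : BT) {A : Finset ℕ} (h : A.card ≠ t.nodes + 1) : cS t A = 0 := by
  induction t generalizing A with
  | nil => exact if_neg h
  | nd l r ihl ihr =>
    rw [cS]
    refine sum_eq_zero fun B hB => ?_
    have := card_sdiff_add_card_eq_card (mem_powerset.1 hB)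
    rw [BT.nodes] at h
    by_cases h1 : B.card = l.nodes + 1
    · rw [ihr (by omega)]
      simp
    · rw [ihl h1]
      simp

theorem cS_empty (t : BT) : cS t ∅ = 0 := cS_eq_zero t (by simp)

theorem admB_nd_append {l r : BT} {A B : Finset ℕ} {u v : List ℕ}
    (hB : B.card = l.nodes + 1) (hu : u ∈ wordsOf B) (hv : v ∈ wordsOf (A \ B)) :
    (admB l u = true ∧ admB r v = true ∧ u.minimum = (u ++ v).minimum
        ∧ v.maximum = (u ++ v).maximum)
      ↔ (B.max < (A \ B).max ∧ B.min < (A \ B).min) ∧ admB l u = true ∧ admB r v = true := by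
  have hne : B.Nonempty := card_pos.1 (by omega)
  have h1 := max_ne_max_of_disjoint (disjoint_sdiff (s := B) (t := A)) hne
  have h2 := min_ne_min_of_disjoint (disjoint_sdiff (s := B) (t := A)) hne
  rw [List.minimum_append, List.maximum_append, ← toFinset_max_eq_maximum,
    ← toFinset_max_eq_maximum, ← toFinset_min_eq_minimum, ← toFinset_min_eq_minimum,
    (mem_wordsOf.1 hu).2, (mem_wordsOf.1 hv).2, left_eq_inf, right_eq_sup,
    le_iff_lt_or_eq, le_iff_lt_or_eq]
  tauto

theorem cS_eq_sum (t : BT) {A : Finset ℕ} (h : A.card = t.nodes + 1) :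
    cS t A = ∑ w ∈ wordsOf A with admB t w = true, evalBT t w := by
  induction t generalizing A with
  | nil =>
    rw [BT.nodes] at h
    simp [cS, h, admB, evalBT]
  | nd l r ihl ihr =>
    rw [BT.nodes] at h
    let K : List ℕ → List ℕ → FW ℚ := fun u v =>
      if admB l u = true ∧ admB r v = true ∧ u.minimum = (u ++ v).minimum
        ∧ v.maximum = (u ++ v).maximum then brakHom (evalBT l u) (evalBT r v) else 0
    have hR : ∑ w ∈ wordsOf A with admB (.nd l r) w = true, evalBT (.nd l r) w
        = ∑ w ∈ wordsOf A, K (w.take (l.nodes + 1)) (w.drop (l.nodes + 1)) := by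
      rw [sum_filter]
      refine sum_congr rfl fun w _ => ?_
      simp only [K, List.take_append_drop, admB, evalBT, Bool.and_eq_true, decide_eq_true_eq,
        brakHom_apply, and_assoc]
    rw [hR, sum_wordsOf_take_drop A (by omega), cS, wedgeS, splitBrak, sum_filter]
    refine sum_congr rfl fun B hB => ?_
    have hc := card_sdiff_add_card_eq_card (mem_powerset.1 hB)
    by_cases hk : B.card = l.nodes + 1
    · rw [if_pos hk, ihl hk, ihr (by omega), sum_filter, sum_filter]
      have hK : ∀ u ∈ wordsOf B, ∀ v ∈ wordsOf (A \ B), K u v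
          = if B.max < (A \ B).max ∧ B.min < (A \ B).min then
              brakHom (if admB l u = true then evalBT l u else 0)
                (if admB r v = true then evalBT r v else 0) else 0 := by
        intro u hu v hv
        simp only [K, admB_nd_append hk hu hv]
        split_ifs <;> first | rfl | tauto | simp only [map_zero, LinearMap.zero_apply]
      rw [sum_congr rfl fun u hu => sum_congr rfl (hK u hu)]
      split_ifs
      · simp only [map_sum, LinearMap.sum_apply]
        exact sum_comm
      · simp
    · rw [if_neg hk, cS_eq_zero l hk]
      simp

theorem cElt_eq_cS (t : BT) : cElt t = cS t (Icc 1 (t.nodes + 1)) := by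
  rw [cS_eq_sum t (by simp), cElt, permWords_eq_wordsOf]

theorem exists_of_catW_ne_zero {x y : FW ℚ} {w : List ℕ} (h : catW x y w ≠ 0) :
    ∃ u v, x u ≠ 0 ∧ y v ≠ 0 ∧ w = u ++ v := by
  rw [catW, Finsupp.sum_apply] at h
  obtain ⟨u, hu, h⟩ := exists_ne_zero_of_sum_ne_zero h
  beta_reduce at h
  rw [Finsupp.sum_apply] at h
  obtain ⟨v, hv, h⟩ := exists_ne_zero_of_sum_ne_zero h
  refine ⟨u, v, Finsupp.mem_support_iff.1 hu, Finsupp.mem_support_iff.1 hv, ?_⟩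
  by_contra hne
  exact h (Finsupp.single_eq_of_ne hne)

theorem cS_support (t : BT) (A : Finset ℕ) {w : List ℕ} (h : cS t A w ≠ 0) : w ∈ wordsOf A := by
  induction t generalizing A w with
  | nil =>
    rw [cS] at h
    split_ifs at h
    · contrapose! h
      rw [Finsupp.finsetSum_apply]
      refine sum_eq_zero fun u hu => ?_
      rw [Finsupp.single_apply, if_neg]
      rintro rfl
      exact h hu
    · simp at h
  | nd l r ihl ihr =>
    rw [cS] at h
    simp only [splitBrak] at h
    rw [Finsupp.finsetSum_apply] at h
    obtain ⟨B, hB, h⟩ := exists_ne_zero_of_sum_ne_zero h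
    rw [mem_powerset] at hB
    split_ifs at h
    · rw [brakHom_apply, brakW, Finsupp.sub_apply] at h
      by_cases h1 : catW (cS l B) (cS r (A \ B)) w = 0
      · rw [h1, zero_sub, neg_ne_zero] at h
        obtain ⟨u, v, hu, hv, rfl⟩ := exists_of_catW_ne_zero h
        refine append_mem_wordsOf sdiff_subset (ihr _ hu) ?_
        rw [Finset.sdiff_sdiff_eq_self hB]
        exact ihl _ hv
      · obtain ⟨u, v, hu, hv, rfl⟩ := exists_of_catW_ne_zero h1
        exact append_mem_wordsOf hB (ihl _ hu) (ihr _ hv)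
    · simp at h

/-! ### Relabelling -/

theorem map_injOn_wordsOf {ρ : ℕ → ℕ} {A : Finset ℕ} (h : Set.InjOn ρ A) :
    Set.InjOn (List.map ρ) (wordsOf A : Set (List ℕ)) := by
  have key : ∀ u ∈ wordsOf A, (u.map ρ).map (Function.invFunOn ρ A) = u := by
    intro u hu
    rw [List.map_map]
    conv_rhs => rw [← List.map_id u]
    refine List.map_congr_left fun a ha => ?_
    exact h.leftInvOn_invFunOn ((mem_of_mem_wordsOf hu).1 ha)
  intro u hu v hv e
  rw [← key u hu, ← key v hv, e]

theorem brakHom_mapDomain (ρ : ℕ → ℕ) (x y : FW ℚ) :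
    brakHom (x.mapDomain (List.map ρ)) (y.mapDomain (List.map ρ))
      = (brakHom x y).mapDomain (List.map ρ) := by
  induction x using Finsupp.induction_linear with
  | zero => simp
  | add a b ha hb => simp [ha, hb, Finsupp.mapDomain_add]
  | single u a =>
    induction y using Finsupp.induction_linear with
    | zero => simp
    | add a b ha hb => simp only [map_add, Finsupp.mapDomain_add, ha, hb]
    | single v b =>
      simp only [brakHom_apply, brakW, catW_single, Finsupp.mapDomain_single, List.map_append,
        sub_eq_add_neg, Finsupp.mapDomain_add, ← Finsupp.single_neg]

theorem max_lt_max_iff {B C : Finset ℕ} : B.max < C.max ↔ ∃ c ∈ C, ∀ b ∈ B, b < c := by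
  constructor
  · intro h
    obtain ⟨c, hc⟩ : ∃ c : ℕ, C.max = c := max_of_nonempty <| by
      rw [nonempty_iff_ne_empty]
      rintro rfl
      simp at h
    refine ⟨c, mem_of_max hc, fun b hb => ?_⟩
    exact WithBot.coe_lt_coe.1 ((le_max hb).trans_lt (h.trans_eq hc))
  · rintro ⟨c, hc, h⟩
    refine lt_of_lt_of_le ?_ (le_max hc)
    rw [max_eq_sup_withBot, Finset.sup_lt_iff (WithBot.bot_lt_coe c)]
    exact fun b hb => WithBot.coe_lt_coe.2 (h b hb)

theorem min_lt_min_iff {B C : Finset ℕ} : B.min < C.min ↔ ∃ b ∈ B, ∀ c ∈ C, b < c := by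
  constructor
  · intro h
    obtain ⟨b, hb⟩ : ∃ b : ℕ, B.min = b := min_of_nonempty <| by
      rw [nonempty_iff_ne_empty]
      rintro rfl
      simp at h
    refine ⟨b, mem_of_min hb, fun c hc => ?_⟩
    exact WithTop.coe_lt_coe.1 ((hb.symm.trans_lt h).trans_le (min_le hc))
  · rintro ⟨b, hb, h⟩
    refine lt_of_le_of_lt (min_le hb) ?_
    rw [min_eq_inf_withTop, Finset.lt_inf_iff (WithTop.coe_lt_top b)]
    exact fun c hc => WithTop.coe_lt_coe.2 (h c hc)

theorem cS_image (t : BT) {A : Finset ℕ} {ρ : ℕ → ℕ} (h : StrictMonoOn ρ A) :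
    cS t (A.image ρ) = (cS t A).mapDomain (List.map ρ) := by
  induction t generalizing A with
  | nil =>
    rw [cS, cS, card_image_of_injOn h.injOn]
    split_ifs with hA
    · obtain ⟨a, rfl⟩ := card_eq_one.1 hA
      simp [wordsOf_singleton, Finsupp.mapDomain_single]
    · simp
  | nd l r ihl ihr =>
    simp only [cS, splitBrak]
    rw [powerset_image,
      sum_image (by simpa using image_injOn_powerset_of_injOn h.injOn),
      Finsupp.mapDomain_finsetSum]
    refine sum_congr rfl fun B hB => ?_
    rw [mem_powerset] at hB
    have hs : A.image ρ \ B.image ρ = (A \ B).image ρ := by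
      ext y
      simp only [mem_sdiff, mem_image]
      constructor
      · rintro ⟨⟨a, ha, rfl⟩, hn⟩
        exact ⟨a, ⟨ha, fun hb => hn ⟨a, hb, rfl⟩⟩, rfl⟩
      · rintro ⟨a, ⟨ha, hb⟩, rfl⟩
        refine ⟨⟨a, ha, rfl⟩, ?_⟩
        rintro ⟨b, hb', e⟩
        exact hb (h.injOn (hB hb') ha e ▸ hb')
    have hlt : ∀ a ∈ A, ∀ b ∈ A, ρ a < ρ b ↔ a < b := fun a ha b hb => h.lt_iff_lt ha hb
    have h1 : (B.image ρ).max < ((A \ B).image ρ).max ↔ B.max < (A \ B).max := by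
      simp only [max_lt_max_iff, mem_image, exists_exists_and_eq_and, forall_exists_index, and_imp,
        forall_apply_eq_imp_iff₂]
      grind
    have h2 : (B.image ρ).min < ((A \ B).image ρ).min ↔ B.min < (A \ B).min := by
      simp only [min_lt_min_iff, mem_image, exists_exists_and_eq_and, forall_exists_index, and_imp,
        forall_apply_eq_imp_iff₂]
      grind
    rw [hs, ihl (h.mono (by simpa using hB)), ihr (h.mono (by simp)), brakHom_mapDomain]
    simp only [h1, h2]
    split_ifs <;> simp

/-- The rank of `x` in `A`. -/
def rankIn (A : Finset ℕ) (x : ℕ) : ℕ := (A.filter (· ≤ x)).card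

theorem rankIn_strictMonoOn (A : Finset ℕ) : StrictMonoOn (rankIn A) A := by
  intro x _ y hy hxy
  refine card_lt_card ⟨fun a => ?_, fun hs => ?_⟩
  · simp only [mem_filter]
    exact fun ha => ⟨ha.1, ha.2.trans hxy.le⟩
  · have := hs (mem_filter.2 ⟨hy, le_rfl⟩)
    simp only [mem_filter] at this
    omega

theorem image_rankIn (A : Finset ℕ) : A.image (rankIn A) = Icc 1 A.card := by
  refine eq_of_subset_of_card_le ?_ ?_
  · intro y hy
    obtain ⟨x, hx, rfl⟩ := mem_image.1 hy
    rw [mem_Icc]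
    exact ⟨card_pos.2 ⟨x, mem_filter.2 ⟨hx, le_rfl⟩⟩, card_filter_le _ _⟩
  · rw [card_image_of_injOn (rankIn_strictMonoOn A).injOn]
    simp

theorem stdW_eq_map_rankIn {A : Finset ℕ} {w : List ℕ} (h : w ∈ wordsOf A) :
    stdW w = w.map (rankIn A) := by
  obtain ⟨hn, rfl⟩ := mem_wordsOf.1 h
  refine List.map_congr_left fun x _ => ?_
  rw [rankIn, ← List.toFinset_card_of_nodup (hn.filter _), List.toFinset_filter]
  simp

theorem cElt_stdW (t : BT) {A : Finset ℕ} (hA : A.card = t.nodes + 1) {w : List ℕ}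
    (h : w ∈ wordsOf A) : (cElt t : FW ℚ) (stdW w) = cS t A w := by
  rw [stdW_eq_map_rankIn h, cElt_eq_cS, ← hA, ← image_rankIn, cS_image t (rankIn_strictMonoOn A)]
  refine Finsupp.mapDomain_apply' (wordsOf A : Set (List ℕ)) _ ?_
    (map_injOn_wordsOf (rankIn_strictMonoOn A).injOn) h
  intro u hu
  exact cS_support t A (Finsupp.mem_support_iff.1 hu)

theorem sum_cS_single (t : BT) (A : Finset ℕ) :
    ∑ w ∈ wordsOf A, cS t A w • (Finsupp.single w 1 : FW ℚ) = cS t A := by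
  conv_rhs => rw [← Finsupp.sum_single (cS t A)]
  rw [Finsupp.sum_of_support_subset (s := wordsOf A) _ _ _ (by simp)]
  · simp
  · intro u hu
    exact cS_support t A (Finsupp.mem_support_iff.1 hu)

/-! ### The preLie product as a set-indexed product -/

/-- The bilinear extension of a product of words given by a condition `p` on the factors. -/
theorem sum_sum_filter_stdW {m n : ℕ} {x y : FW ℚ} (hx : ∀ u, x u ≠ 0 → u.length = m)
    (hy : ∀ v, y v ≠ 0 → v.length = n) (p : ℕ → List ℕ → List ℕ → Prop)
    [∀ k u v, Decidable (p k u v)] :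
    (x.sum fun u a => y.sum fun v b => (a * b) •
        ∑ γ ∈ permWords (u.length + v.length) with
          stdW (γ.take u.length) = u ∧ stdW (γ.drop u.length) = v
            ∧ p (u.length + v.length) (γ.take u.length) (γ.drop u.length),
          (Finsupp.single γ 1 : FW ℚ))
      = ∑ γ ∈ permWords (m + n), if p (m + n) (γ.take m) (γ.drop m) then
          (x (stdW (γ.take m)) * y (stdW (γ.drop m))) • Finsupp.single γ 1 else 0 := by
  have h : ∀ u ∈ x.support, ∀ v ∈ y.support, (x u * y v) •
        ∑ γ ∈ permWords (u.length + v.length) with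
          stdW (γ.take u.length) = u ∧ stdW (γ.drop u.length) = v
            ∧ p (u.length + v.length) (γ.take u.length) (γ.drop u.length),
          (Finsupp.single γ 1 : FW ℚ)
      = ∑ γ ∈ permWords (m + n), if stdW (γ.take m) = u then if stdW (γ.drop m) = v then
          if p (m + n) (γ.take m) (γ.drop m) then
            (x u * y v) • Finsupp.single γ 1 else 0 else 0 else 0 := by
    intro u hu v hv
    rw [hx u (Finsupp.mem_support_iff.1 hu), hy v (Finsupp.mem_support_iff.1 hv), smul_sum,
      sum_filter]
    refine sum_congr rfl fun γ _ => ?_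
    rw [ite_and, ite_and]
  simp only [Finsupp.sum]
  rw [sum_congr rfl fun u hu => sum_congr rfl (h u hu)]
  rw [sum_congr rfl fun u _ => sum_comm, sum_comm]
  refine sum_congr rfl fun γ _ => ?_
  simp only [sum_ite_irrel, sum_const_zero, sum_ite_eq, Finsupp.mem_support_iff]
  split_ifs <;> simp_all

theorem length_of_cElt_ne_zero (t : BT) (u : List ℕ) (h : (cElt t : FW ℚ) u ≠ 0) :
    u.length = t.nodes + 1 := by
  rw [cElt_eq_cS] at h
  simpa using length_of_mem_wordsOf (cS_support t _ h)

theorem mem_iff_max_lt_max {N : ℕ} (hN : 1 ≤ N) {B : Finset ℕ} (hB : B ⊆ Icc 1 N) :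
    N ∈ B ↔ (Icc 1 N \ B).max < B.max := by
  rw [max_lt_max_iff]
  constructor
  · intro h
    refine ⟨N, h, fun b hb => ?_⟩
    simp only [mem_sdiff, mem_Icc] at hb
    rcases hb.1.2.lt_or_eq with h' | rfl
    · exact h'
    · exact absurd h hb.2
  · rintro ⟨c, hc, h⟩
    by_contra hn
    have := h N (mem_sdiff.2 ⟨mem_Icc.2 ⟨hN, le_rfl⟩, hn⟩)
    have := (mem_Icc.1 (hB hc)).2
    omega

theorem sum_cElt_stdW (t s : BT) (p : ℕ → List ℕ → List ℕ → Prop)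
    [∀ k u v, Decidable (p k u v)] (q : Finset ℕ → Finset ℕ → Prop) [∀ B C, Decidable (q B C)]
    (hpq : ∀ B ⊆ Icc 1 (t.nodes + 1 + (s.nodes + 1)), ∀ u ∈ wordsOf B,
      ∀ v ∈ wordsOf (Icc 1 (t.nodes + 1 + (s.nodes + 1)) \ B),
      p (t.nodes + 1 + (s.nodes + 1)) u v
        ↔ q B (Icc 1 (t.nodes + 1 + (s.nodes + 1)) \ B)) :
    ∑ γ ∈ permWords (t.nodes + 1 + (s.nodes + 1)),
        (if p (t.nodes + 1 + (s.nodes + 1)) (γ.take (t.nodes + 1)) (γ.drop (t.nodes + 1)) then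
          ((cElt t : FW ℚ) (stdW (γ.take (t.nodes + 1)))
            * (cElt s : FW ℚ) (stdW (γ.drop (t.nodes + 1)))) • (Finsupp.single γ 1 : FW ℚ) else 0)
      = ∑ B ∈ (Icc 1 (t.nodes + 1 + (s.nodes + 1))).powerset,
          if q B (Icc 1 (t.nodes + 1 + (s.nodes + 1)) \ B) then
            catHom (cS t B) (cS s (Icc 1 (t.nodes + 1 + (s.nodes + 1)) \ B)) else 0 := by
  set N := t.nodes + 1 + (s.nodes + 1) with hN
  let K : List ℕ → List ℕ → FW ℚ := fun u v => if p N u v then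
    ((cElt t : FW ℚ) (stdW u) * (cElt s : FW ℚ) (stdW v)) • Finsupp.single (u ++ v) 1 else 0
  have hK := sum_wordsOf_take_drop (Icc 1 N) (k := t.nodes + 1) (by simp; omega) K
  simp only [K, List.take_append_drop] at hK
  rw [permWords_eq_wordsOf, hK, sum_filter]
  refine sum_congr rfl fun B hB => ?_
  rw [mem_powerset] at hB
  have hc := card_sdiff_add_card_eq_card hB
  rw [Nat.card_Icc] at hc
  by_cases hk : B.card = t.nodes + 1
  · rw [if_pos hk]
    have h : ∀ u ∈ wordsOf B, ∀ v ∈ wordsOf (Icc 1 N \ B), (if p N u v then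
        ((cElt t : FW ℚ) (stdW u) * (cElt s : FW ℚ) (stdW v)) •
          (Finsupp.single (u ++ v) 1 : FW ℚ) else 0)
        = if q B (Icc 1 N \ B) then catHom (cS t B u • Finsupp.single u 1)
            (cS s (Icc 1 N \ B) v • Finsupp.single v 1) else 0 := by
      intro u hu v hv
      rw [cElt_stdW t hk hu, cElt_stdW s (by omega) hv]
      simp only [hpq B hB u hu v hv, map_smul, LinearMap.smul_apply, smul_smul, catHom_apply,
        catW_single, mul_one, mul_comm]
    rw [sum_congr rfl fun u hu => sum_congr rfl (h u hu)]
    split_ifs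
    · conv_rhs => rw [← sum_cS_single t, ← sum_cS_single s]
      simp only [map_sum, LinearMap.sum_apply]
      exact sum_comm
    · simp
  · rw [if_neg hk, cS_eq_zero t hk]
    simp

theorem preLieW_cElt (t s : BT) : preLieW (cElt t : FW ℚ) (cElt s)
    = preS (cS t) (cS s) (Icc 1 (t.nodes + 1 + (s.nodes + 1))) := by
  have h1 : succExt (cElt t : FW ℚ) (cElt s)
      = ∑ B ∈ (Icc 1 (t.nodes + 1 + (s.nodes + 1))).powerset,
          if B.max < (Icc 1 (t.nodes + 1 + (s.nodes + 1)) \ B).max then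
            catHom (cS t B) (cS s (Icc 1 (t.nodes + 1 + (s.nodes + 1)) \ B)) else 0 := by
    refine (sum_sum_filter_stdW (length_of_cElt_ne_zero t) (length_of_cElt_ne_zero s)
      fun k _ v => k ∈ v).trans
        (sum_cElt_stdW t s (fun k _ v => k ∈ v) (fun B C => B.max < C.max) ?_)
    intro B hB u hu v hv
    rw [mem_of_mem_wordsOf hv, mem_iff_max_lt_max (by omega) sdiff_subset,
      Finset.sdiff_sdiff_eq_self hB]
  have h2 : precExt (cElt s : FW ℚ) (cElt t)
      = ∑ B ∈ (Icc 1 (t.nodes + 1 + (s.nodes + 1))).powerset,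
          if B.max < (Icc 1 (t.nodes + 1 + (s.nodes + 1)) \ B).max then
            catHom (cS s (Icc 1 (t.nodes + 1 + (s.nodes + 1)) \ B)) (cS t B) else 0 := by
    refine (sum_sum_filter_stdW (length_of_cElt_ne_zero s) (length_of_cElt_ne_zero t)
      fun k u _ => k ∈ u).trans
        ((sum_cElt_stdW s t (fun k u _ => k ∈ u) (fun B C => C.max < B.max) ?_).trans ?_)
    · intro B hB u hu v hv
      rw [mem_of_mem_wordsOf hu, mem_iff_max_lt_max (by omega) hB]
    · rw [add_comm (s.nodes + 1)]
      generalize Icc 1 (t.nodes + 1 + (s.nodes + 1)) = A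
      refine sum_bij' (fun B _ => A \ B) (fun B _ => A \ B) ?_ ?_ ?_ ?_ ?_
      · exact fun B _ => mem_powerset.2 sdiff_subset
      · exact fun B _ => mem_powerset.2 sdiff_subset
      · exact fun B hB => Finset.sdiff_sdiff_eq_self (mem_powerset.1 hB)
      · exact fun B hB => Finset.sdiff_sdiff_eq_self (mem_powerset.1 hB)
      · intro B hB
        rw [Finset.sdiff_sdiff_eq_self (mem_powerset.1 hB)]
  rw [preLieW, h1, h2, ← sum_sub_distrib]
  refine sum_congr rfl fun B _ => ?_
  split_ifs
  · rfl
  · simp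

/-! ### Linear extension to combinations of trees -/

/-- The linear extension of `cS` to combinations of trees. -/
noncomputable def chatS (x : BT →₀ ℤ) : Finset ℕ → FW ℚ := x.sum fun t a => (a : ℚ) • cS t

theorem chatS_single (t : BT) (a : ℤ) : chatS (Finsupp.single t a) = (a : ℚ) • cS t := by
  simp [chatS]

theorem chatS_zero : chatS 0 = 0 := Finsupp.sum_zero_index

theorem chatS_add (x y : BT →₀ ℤ) : chatS (x + y) = chatS x + chatS y :=
  Finsupp.sum_add_index' (by simp) (by simp [add_smul])

theorem chatS_sub (x y : BT →₀ ℤ) : chatS (x - y) = chatS x - chatS y :=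
  Finsupp.sum_sub_index (by simp [sub_smul])

theorem wedge2_single (s t : BT) (a b : ℤ) :
    wedge2 (Finsupp.single s a) (Finsupp.single t b) = Finsupp.single (.nd s t) (a * b) := by
  simp [wedge2]

theorem wedge2_add_left (x y z : BT →₀ ℤ) : wedge2 (x + y) z = wedge2 x z + wedge2 y z := by
  unfold wedge2
  rw [Finsupp.sum_add_index']
  · simp
  · intro u a b
    rw [← Finsupp.sum_add]
    simp [add_mul]

theorem wedge2_add_right (x y z : BT →₀ ℤ) : wedge2 x (y + z) = wedge2 x y + wedge2 x z := by
  unfold wedge2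
  rw [← Finsupp.sum_add]
  congr 1
  funext u a
  rw [Finsupp.sum_add_index']
  · simp
  · simp [mul_add]

theorem chatS_wedge2 (x y : BT →₀ ℤ) : chatS (wedge2 x y) = wedgeS (chatS x) (chatS y) := by
  have zl : ∀ g, wedgeS 0 g = 0 := fun g => by
    funext A
    simp [splitBrak]
  have zr : ∀ g, wedgeS g 0 = 0 := fun g => by
    funext A
    simp [splitBrak]
  induction x using Finsupp.induction_linear with
  | zero => rw [chatS_zero, zl, wedge2, Finsupp.sum_zero_index, chatS_zero]
  | add a b ha hb =>
    rw [wedge2_add_left, chatS_add, ha, hb, chatS_add]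
    exact (splitBrak_add_left _ _ _ _).symm
  | single s a =>
    induction y using Finsupp.induction_linear with
    | zero => rw [chatS_zero, zr, wedge2, Finsupp.sum_single_index] <;>
        simp [Finsupp.sum_zero_index, chatS_zero]
    | add b c hb hc =>
      rw [wedge2_add_right, chatS_add, hb, hc, chatS_add]
      exact (splitBrak_add_right _ _ _ _).symm
    | single t b =>
      rw [wedge2_single, chatS_single, chatS_single, chatS_single, cS_nd]
      simp only [wedgeS, splitBrak_smul_left, splitBrak_smul_right, smul_smul, Int.cast_mul,
        mul_comm]

theorem preS_cS_nil (f : Finset ℕ → FW ℚ) (hf : f ∅ = 0) :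
    preS f (cS .nil) = wedgeS f (cS .nil) := by
  funext A
  refine sum_congr rfl fun B _ => ?_
  by_cases hA : (A \ B).card = 1
  · obtain rfl | ⟨b, hb⟩ := B.eq_empty_or_nonempty
    · simp [hf]
    obtain ⟨a, ha⟩ := card_eq_one.1 hA
    refine if_congr ?_ rfl rfl
    beta_reduce
    rw [ha, iff_self_and, max_lt_max_iff, min_lt_min_iff]
    rintro ⟨c, hc, h⟩
    rw [mem_singleton] at hc
    subst hc
    exact ⟨b, hb, by simpa using h b hb⟩
  · rw [cS_eq_zero .nil hA]
    simp

theorem preS_cS (t s : BT) : preS (cS t) (cS s) = chatS (wcomb t s) := by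
  induction s with
  | nil => rw [preS_cS_nil _ (cS_empty t), wcomb, chatS_single, cS_nd, Int.cast_one, one_smul]
  | nd l r ihl ihr =>
    rw [wcomb, chatS_sub, chatS_sub, chatS_add, chatS_add, chatS_wedge2, chatS_wedge2, ← ihl, ← ihr]
    simp only [chatS_single, Int.cast_one, one_smul]
    rw [cS_nd l r, preS_wedgeS _ _ _ (cS_empty t)]
    simp only [cS_nd]

theorem nodes_of_wedge2_ne_zero {x y : BT →₀ ℤ} {m n : ℕ} (hx : ∀ t, x t ≠ 0 → t.nodes = m)
    (hy : ∀ t, y t ≠ 0 → t.nodes = n) (t : BT) (h : wedge2 x y t ≠ 0) :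
    t.nodes = m + n + 1 := by
  rw [wedge2, Finsupp.sum_apply] at h
  obtain ⟨u, hu, h⟩ := exists_ne_zero_of_sum_ne_zero h
  beta_reduce at h
  rw [Finsupp.sum_apply] at h
  obtain ⟨v, hv, h⟩ := exists_ne_zero_of_sum_ne_zero h
  have ht : t = .nd u v := by
    by_contra hne
    exact h (Finsupp.single_eq_of_ne hne)
  rw [ht, BT.nodes, hx u (Finsupp.mem_support_iff.1 hu), hy v (Finsupp.mem_support_iff.1 hv)]

theorem nodes_of_single_ne_zero {s t : BT} {a : ℤ} (h : Finsupp.single s a t ≠ 0) :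
    t.nodes = s.nodes := by
  by_contra hne
  exact h (Finsupp.single_eq_of_ne fun e => hne (by rw [e]))

theorem nodes_of_wcomb_ne_zero (t s r : BT) (h : wcomb t s r ≠ 0) :
    r.nodes = t.nodes + s.nodes + 1 := by
  induction s generalizing r with
  | nil => rw [wcomb] at h; rw [nodes_of_single_ne_zero h]; rfl
  | nd u v ihu ihv =>
    contrapose! h
    simp only [wcomb, Finsupp.sub_apply, Finsupp.add_apply]
    simp only [BT.nodes] at h
    have e1 : ∀ z : BT, z.nodes = t.nodes + (u.nodes + v.nodes + 1) + 1 →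
        Finsupp.single z (1 : ℤ) r = 0 := fun z hz => by
      by_contra hne
      exact h ((nodes_of_single_ne_zero hne).trans hz)
    have e2 : wedge2 (wcomb t u) (Finsupp.single v 1) r = 0 := by
      by_contra hne
      have := nodes_of_wedge2_ne_zero ihu (fun _ => nodes_of_single_ne_zero) r hne
      omega
    have e3 : wedge2 (Finsupp.single u 1) (wcomb t v) r = 0 := by
      by_contra hne
      have := nodes_of_wedge2_ne_zero (fun _ => nodes_of_single_ne_zero) ihv r hne
      omega
    rw [e1, e2, e3, e1, e1] <;> (try simp only [BT.nodes]) <;> omega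

theorem chatS_wcomb_Icc (t s : BT) :
    chatS (wcomb t s) (Icc 1 (t.nodes + 1 + (s.nodes + 1))) = chat (wcomb t s) := by
  rw [chatS, chat, Finsupp.sum, Finset.sum_apply]
  refine sum_congr rfl fun r hr => ?_
  beta_reduce
  rw [Pi.smul_apply, cElt_eq_cS, nodes_of_wcomb_ne_zero t s r (Finsupp.mem_support_iff.1 hr)]
  congr 3
  omega

theorem stmt12 :
    (∀ t1 t2 : BT, preLieW (cElt t1 : FW ℚ) (cElt t2) = chat (wcomb t1 t2)) ∧
    ∀ t1 t2 : BT, preLieW (cElt t1 : FW ℚ) (cElt t2)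
      ∈ Submodule.span ℚ (Set.range (cElt : BT → FW ℚ)) := by
  have key : ∀ t1 t2 : BT, preLieW (cElt t1 : FW ℚ) (cElt t2) = chat (wcomb t1 t2) :=
    fun t1 t2 => by rw [preLieW_cElt, preS_cS, chatS_wcomb_Icc]
  refine ⟨key, fun t1 t2 => ?_⟩
  rw [key]
  exact Submodule.sum_mem _ fun t _ =>
    Submodule.smul_mem _ _ (Submodule.subset_span (Set.mem_range_self t))
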